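/- Work in the nonstationary SGD framework on a filtered probability space: m_{t+1} : ℝ^d → ℝ^d with 𝓕_t-measurable values, uniformly μ-strongly monotone and L-Lipschitz; θ⋆_{t+1} 𝓕_t-measurable with m_{t+1}(θ⋆_{t+1}) = 0 a.s.; adapted iterates θ_{t+1} = θ_t − γ m_{t+1}(θ_t) − γ ξ_{t+1}(θ_t); gradient noise ξ_{t+1}(θ_t) 𝓕_{t+1}-measurable with 𝔼[ξ_{t+1}(θ_t) | 𝓕_t] = 0 a.s.; θ₀ deterministic. Assume the noise is conditionally σ-sub-Gaussian along the iterates: for every 𝓕_t-measurable random unit vector u ∈ ℝ^d, 𝔼[exp(⟨u, ξ_{t+1}(θ_t)⟩²/σ²) | 𝓕_t] ≤ 2 a.s. Define Δ_ℓ := θ⋆_ℓ − θ⋆_{ℓ+1}, 𝔇_t := ∑_{ℓ=0}^{t−1} (1 − γμ/2)^{t−ℓ−1}‖Δ_ℓ‖² and 𝔇_t^{(2)} := ∑_{ℓ=0}^{t−1} (1 − γμ/2)^{2(t−ℓ−1)}‖Δ_ℓ‖². Then there exists a universal constant C > 0 such that for all T ≥ 1, all 0 < γ ≤ min{μ/L²,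 1/L}, and all δ ∈ (0,1), with probability at least 1 − δ: ‖θ_T − θ⋆_T‖² ≤ C [ (1 − γμ/2)^T ‖θ₀ − θ⋆₀‖² + 𝔇_T/(γμ) + dσ²γ/μ + (dσ²γ² + d²σ⁴γ³/μ) log(2T/δ) + (σ²γ/μ + γ²σ² max_{1≤t≤T} 𝔇_t^{(2)}) log(2T/δ) ]. -/

import Mathlib

open MeasureTheory
open scoped InnerProductSpace ENNReal

open ProbabilityTheory in
/-- An integral over the joint law of `(X, Y)` disintegrates along `condDistrib Y X P`. -/
lemma lintegral_comp_prodMk_eq_lintegral_condDistrib {Ω Ω' E : Type*} {m0 : MeasurableSpace Ω}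
    [MeasurableSpace Ω'] [MeasurableSpace E] [StandardBorelSpace E] [Nonempty E]
    {P : Measure Ω} [IsFiniteMeasure P] {X : Ω → Ω'} {Y : Ω → E}
    (hX : Measurable X) (hY : Measurable Y) {f : Ω' × E → ℝ≥0∞} (hf : Measurable f) :
    ∫⁻ ω, f (X ω, Y ω) ∂P = ∫⁻ ω, ∫⁻ y, f (X ω, y) ∂(condDistrib Y X P (X ω)) ∂P := by
  rw [← lintegral_map hf (hX.prodMk hY), ← compProd_map_condDistrib hY.aemeasurable,
    Measure.lintegral_compProd hf]
  exact lintegral_map hf.lintegral_kernel_prod_right' hX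

lemma Real.exp_le_add_exp_sq (x : ℝ) : Real.exp x ≤ x + Real.exp (x ^ 2) := by
  have h2 := Real.add_one_le_exp (x ^ 2)
  rcases le_or_gt 1 x with h | h
  · have : Real.exp x ≤ Real.exp (x ^ 2) := Real.exp_le_exp.2 (by nlinarith)
    linarith
  · rcases le_or_gt (-1) x with h' | h'
    · have := (abs_le.1 (Real.abs_exp_sub_one_sub_id_le (abs_le.2 ⟨h', h.le⟩))).2
      linarith
    · have : Real.exp x ≤ 1 := Real.exp_le_one_iff.2 (by linarith)
      nlinarith

/-- The chord bound for `exp (p * z)` between the exponents `0` and `z`. -/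
lemma Real.exp_mul_le_one_add_mul {p : ℝ} (hp0 : 0 ≤ p) (hp1 : p ≤ 1) (z : ℝ) :
    Real.exp (p * z) ≤ 1 + p * (Real.exp z - 1) := by
  have := convexOn_exp.2 (Set.mem_univ 0) (Set.mem_univ z) (sub_nonneg.2 hp1) hp0 (by ring)
  simp only [smul_eq_mul, mul_zero, zero_add, Real.exp_zero] at this
  linarith

lemma lintegral_ofReal_le_of_le_integrable {E : Type*} [MeasurableSpace E] {ν : Measure E}
    {f g : E → ℝ} {c : ℝ} (hf : ∀ x, 0 ≤ f x) (hfg : ∀ x, f x ≤ g x) (hg : Integrable g ν)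
    (hc : ∫ x, g x ∂ν ≤ c) : ∫⁻ x, ENNReal.ofReal (f x) ∂ν ≤ ENNReal.ofReal c :=
  calc ∫⁻ x, ENNReal.ofReal (f x) ∂ν ≤ ∫⁻ x, ENNReal.ofReal (g x) ∂ν :=
        lintegral_mono fun x => ENNReal.ofReal_le_ofReal (hfg x)
    _ = ENNReal.ofReal (∫ x, g x ∂ν) :=
        (ofReal_integral_eq_lintegral_ofReal hg
          (Filter.Eventually.of_forall fun x => (hf x).trans (hfg x))).symm
    _ ≤ ENNReal.ofReal c := ENNReal.ofReal_le_ofReal hc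

lemma integral_one_add_mul_sub_one_le {E : Type*} [MeasurableSpace E] {ν : Measure E}
    [IsProbabilityMeasure ν] {f : E → ℝ} (hf : Integrable f ν) (hf2 : ∫ x, f x ∂ν ≤ 2)
    {p : ℝ} (hp : 0 ≤ p) :
    Integrable (fun x => 1 + p * (f x - 1)) ν ∧ ∫ x, (1 + p * (f x - 1)) ∂ν ≤ 1 + p := by
  have hsub : Integrable (fun x => p * (f x - 1)) ν := (hf.sub (integrable_const 1)).const_mul p
  refine ⟨(integrable_const 1).add hsub, ?_⟩
  rw [integral_add (integrable_const 1) hsub, integral_const_mul,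
    integral_sub hf (integrable_const 1)]
  simp only [integral_const, probReal_univ, smul_eq_mul, mul_one]
  nlinarith

/-- A centered variable with `𝔼 exp (Y² / σ²) ≤ 2` has `𝔼 exp (vY) ≤ exp (v²σ²)`. -/
lemma lintegral_exp_mul_le_of_subgaussian {E : Type*} [MeasurableSpace E] {ν : Measure E}
    [IsProbabilityMeasure ν] {y : E → ℝ} {σ : ℝ} (hσ : 0 < σ) (hy : Integrable y ν)
    (hy0 : ∫ x, y x ∂ν = 0) (hexp : Integrable (fun x => Real.exp (y x ^ 2 / σ ^ 2)) ν)
    (hexp2 : ∫ x, Real.exp (y x ^ 2 / σ ^ 2) ∂ν ≤ 2) (v : ℝ) :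
    ∫⁻ x, ENNReal.ofReal (Real.exp (v * y x)) ∂ν ≤ ENNReal.ofReal (Real.exp (v ^ 2 * σ ^ 2)) := by
  rcases le_or_gt (v ^ 2 * σ ^ 2) 1 with h | h
  · obtain ⟨hi, hle⟩ := integral_one_add_mul_sub_one_le hexp hexp2
      (show 0 ≤ v ^ 2 * σ ^ 2 by positivity)
    refine lintegral_ofReal_le_of_le_integrable
      (g := fun x => v * y x + (1 + v ^ 2 * σ ^ 2 * (Real.exp (y x ^ 2 / σ ^ 2) - 1)))
      (fun x => (Real.exp_pos _).le) (fun x => ?_)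
      ((hy.const_mul v).add hi) ?_
    · refine (Real.exp_le_add_exp_sq _).trans ?_
      have := Real.exp_mul_le_one_add_mul (by positivity) h (y x ^ 2 / σ ^ 2)
      rw [show v ^ 2 * σ ^ 2 * (y x ^ 2 / σ ^ 2) = (v * y x) ^ 2 by field_simp] at this
      linarith
    · rw [integral_add (hy.const_mul v) hi, integral_const_mul, hy0]
      have := Real.add_one_le_exp (v ^ 2 * σ ^ 2)
      linarith
  · obtain ⟨hi, hle⟩ := integral_one_add_mul_sub_one_le hexp hexp2
      (show (0 : ℝ) ≤ 1 / 2 by norm_num)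
    refine lintegral_ofReal_le_of_le_integrable
      (g := fun x => Real.exp (v ^ 2 * σ ^ 2 / 2)
        * (1 + 1 / 2 * (Real.exp (y x ^ 2 / σ ^ 2) - 1)))
      (fun x => (Real.exp_pos _).le) (fun x => ?_)
      (hi.const_mul _) ?_
    · have h1 := Real.exp_mul_le_one_add_mul (p := 1 / 2) (by norm_num) (by norm_num)
        (y x ^ 2 / σ ^ 2)
      have h2 : v * y x ≤ v ^ 2 * σ ^ 2 / 2 + 1 / 2 * (y x ^ 2 / σ ^ 2) := by
        have h3 : v * y x = (v * σ) * (y x / σ) := by field_simp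
        have h4 : y x ^ 2 / σ ^ 2 = (y x / σ) ^ 2 := by rw [div_pow]
        rw [h3, h4]
        nlinarith [sq_nonneg (v * σ - y x / σ)]
      calc Real.exp (v * y x)
          ≤ Real.exp (v ^ 2 * σ ^ 2 / 2) * Real.exp (1 / 2 * (y x ^ 2 / σ ^ 2)) := by
            rw [← Real.exp_add]; exact Real.exp_le_exp.2 h2
        _ ≤ _ := mul_le_mul_of_nonneg_left h1 (Real.exp_pos _).le
    · rw [integral_const_mul]
      calc _ ≤ Real.exp (v ^ 2 * σ ^ 2 / 2) * Real.exp (v ^ 2 * σ ^ 2 / 2) := by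
            refine mul_le_mul_of_nonneg_left ?_ (Real.exp_pos _).le
            have := Real.add_one_le_exp (v ^ 2 * σ ^ 2 / 2)
            linarith
        _ = Real.exp (v ^ 2 * σ ^ 2) := by rw [← Real.exp_add]; ring_nf

/-- Sums of squares of `d` sub-Gaussian variables, with no independence required. -/
lemma lintegral_exp_mul_sum_sq_le {E : Type*} [MeasurableSpace E] {ν : Measure E}
    [IsProbabilityMeasure ν] {d : ℕ} (hd : 1 ≤ d) {y : Fin d → E → ℝ} {σ : ℝ} (hσ : 0 < σ)
    (hexp : ∀ i, Integrable (fun x => Real.exp (y i x ^ 2 / σ ^ 2)) ν)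
    (hexp2 : ∀ i, ∫ x, Real.exp (y i x ^ 2 / σ ^ 2) ∂ν ≤ 2) {r : ℝ} (hr : 0 ≤ r)
    (hr1 : r * d * σ ^ 2 ≤ 1) :
    ∫⁻ x, ENNReal.ofReal (Real.exp (r * ∑ i, y i x ^ 2)) ∂ν
      ≤ ENNReal.ofReal (Real.exp (r * d * σ ^ 2)) := by
  have hd0 : (0 : ℝ) < d := by exact_mod_cast hd
  set p := r * d * σ ^ 2 with hp
  have hp0 : 0 ≤ p := by positivity
  have hg := fun i => integral_one_add_mul_sub_one_le (hexp i) (hexp2 i) hp0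
  refine lintegral_ofReal_le_of_le_integrable
    (g := fun x => ∑ i, (d : ℝ)⁻¹ * (1 + p * (Real.exp (y i x ^ 2 / σ ^ 2) - 1)))
    (fun x => (Real.exp_pos _).le) (fun x => ?_)
    (integrable_finsetSum _ fun i _ => (hg i).1.const_mul _) ?_
  · have h := convexOn_exp.map_sum_le (t := Finset.univ) (w := fun _ : Fin d => (d : ℝ)⁻¹)
      (p := fun i => p * (y i x ^ 2 / σ ^ 2)) (fun _ _ => by positivity)
      (by simp [hd0.ne']) (fun _ _ => Set.mem_univ _)
    simp only [smul_eq_mul] at h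
    have h2 : ∑ i, (d : ℝ)⁻¹ * (p * (y i x ^ 2 / σ ^ 2)) = r * ∑ i, y i x ^ 2 := by
      rw [Finset.mul_sum]
      refine Finset.sum_congr rfl fun i _ => ?_
      rw [hp]; field_simp
    rw [h2] at h
    refine h.trans (Finset.sum_le_sum fun i _ => ?_)
    exact mul_le_mul_of_nonneg_left (Real.exp_mul_le_one_add_mul hp0 hr1 _) (by positivity)
  · rw [integral_finsetSum _ fun i _ => (hg i).1.const_mul _]
    simp only [integral_const_mul]
    refine (Finset.sum_le_sum fun i _ =>
      mul_le_mul_of_nonneg_left (hg i).2 (inv_nonneg.2 hd0.le)).trans ?_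
    have := Real.add_one_le_exp p
    rw [Finset.sum_const, Finset.card_univ, Fintype.card_fin, nsmul_eq_mul,
      mul_inv_cancel_left₀ hd0.ne']
    linarith

/-- Joint exponential moment of a linear and a quadratic functional of a sub-Gaussian vector. -/
lemma lintegral_exp_inner_add_norm_sq_le {d : ℕ} (hd : 1 ≤ d)
    {ν : Measure (EuclideanSpace ℝ (Fin d))} [IsProbabilityMeasure ν] {σ : ℝ} (hσ : 0 < σ)
    (hint : Integrable (fun x => x) ν) (hmean : ∫ x, x ∂ν = 0)
    (hcoord : ∀ i, Integrable
      (fun x => Real.exp (⟪EuclideanSpace.single i (1 : ℝ), x⟫_ℝ ^ 2 / σ ^ 2)) ν ∧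
      ∫ x, Real.exp (⟪EuclideanSpace.single i (1 : ℝ), x⟫_ℝ ^ 2 / σ ^ 2) ∂ν ≤ 2)
    {b u : EuclideanSpace ℝ (Fin d)} (hb : b = ‖b‖ • u)
    (hu : Integrable (fun x => Real.exp (⟪u, x⟫_ℝ ^ 2 / σ ^ 2)) ν ∧
      ∫ x, Real.exp (⟪u, x⟫_ℝ ^ 2 / σ ^ 2) ∂ν ≤ 2)
    {r : ℝ} (hr : 0 ≤ r) (hr1 : 2 * r * d * σ ^ 2 ≤ 1) :
    ∫⁻ x, ENNReal.ofReal (Real.exp (⟪b, x⟫_ℝ + r * ‖x‖ ^ 2)) ∂ν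
      ≤ ENNReal.ofReal (Real.exp (4 * σ ^ 2 * ‖b‖ ^ 2 + 2 * r * d * σ ^ 2)) := by
  have hy : Integrable (fun x => ⟪u, x⟫_ℝ) ν := hint.const_inner u
  have hy0 : ∫ x, ⟪u, x⟫_ℝ ∂ν = 0 := by
    rw [integral_inner hint u, hmean, inner_zero_right]
  have h1 := lintegral_exp_mul_le_of_subgaussian hσ hy hy0 hu.1 hu.2 (2 * ‖b‖)
  have h2 := lintegral_exp_mul_sum_sq_le (ν := ν) hd
    (y := fun i x => ⟪EuclideanSpace.single i (1 : ℝ), x⟫_ℝ) hσ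
    (fun i => (hcoord i).1) (fun i => (hcoord i).2) (r := 2 * r) (by positivity) hr1
  have hA : 0 ≤ (2 * ‖b‖) ^ 2 * σ ^ 2 := by positivity
  have hB : 0 ≤ 2 * r * d * σ ^ 2 := by positivity
  set A := (2 * ‖b‖) ^ 2 * σ ^ 2
  set B := 2 * r * d * σ ^ 2
  have hpt : ∀ x : EuclideanSpace ℝ (Fin d),
      ENNReal.ofReal (Real.exp (⟪b, x⟫_ℝ + r * ‖x‖ ^ 2)) ≤
        ENNReal.ofReal (1 / 2) * (ENNReal.ofReal (Real.exp (2 * ‖b‖ * ⟪u, x⟫_ℝ)) +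
        ENNReal.ofReal
          (Real.exp (2 * r * ∑ i, ⟪EuclideanSpace.single i (1 : ℝ), x⟫_ℝ ^ 2))) := fun x => by
    rw [← ENNReal.ofReal_add (Real.exp_pos _).le (Real.exp_pos _).le,
      ← ENNReal.ofReal_mul (by norm_num)]
    refine ENNReal.ofReal_le_ofReal ?_
    have hs : ∑ i, ⟪EuclideanSpace.single i (1 : ℝ), x⟫_ℝ ^ 2 = ‖x‖ ^ 2 := by
      simp [EuclideanSpace.real_norm_sq_eq, EuclideanSpace.inner_single_left]
    have hbx : ⟪b, x⟫_ℝ = ‖b‖ * ⟪u, x⟫_ℝ := by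
      conv_lhs => rw [hb]
      rw [real_inner_smul_left]
    rw [hs, hbx]
    generalize ⟪u, x⟫_ℝ = y
    have h := convexOn_exp.2 (Set.mem_univ (2 * ‖b‖ * y)) (Set.mem_univ (2 * r * ‖x‖ ^ 2))
      (show (0 : ℝ) ≤ 1 / 2 by norm_num) (show (0 : ℝ) ≤ 1 / 2 by norm_num) (by norm_num)
    rw [smul_eq_mul, smul_eq_mul, smul_eq_mul, smul_eq_mul] at h
    rw [show ‖b‖ * y + r * ‖x‖ ^ 2 = 1 / 2 * (2 * ‖b‖ * y) + 1 / 2 * (2 * r * ‖x‖ ^ 2) by ring]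
    linarith
  refine (lintegral_mono hpt).trans ?_
  rw [lintegral_const_mul _ (by fun_prop), lintegral_add_left (by fun_prop)]
  refine (mul_le_mul_right (add_le_add h1 h2) _).trans ?_
  rw [← ENNReal.ofReal_add (Real.exp_pos _).le (Real.exp_pos _).le,
      ← ENNReal.ofReal_mul (by norm_num)]
  refine ENNReal.ofReal_le_ofReal ?_
  have e1 : Real.exp A ≤ Real.exp (A + B) := Real.exp_le_exp.2 (by linarith)
  have e2 : Real.exp B ≤ Real.exp (A + B) := Real.exp_le_exp.2 (by linarith)
  have e3 : A + B = 4 * σ ^ 2 * ‖b‖ ^ 2 + B := by simp only [A]; ring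
  rw [← e3]
  linarith

open ProbabilityTheory in
/-- Conditional version of `lintegral_exp_inner_add_norm_sq_le`, in integrated form. -/
lemma lintegral_exp_add_inner_add_norm_sq_le {Ω Ω' : Type*} {m0 : MeasurableSpace Ω}
    {m' : MeasurableSpace Ω'} {P : Measure Ω} [IsProbabilityMeasure P] {d : ℕ} (hd : 1 ≤ d)
    {X : Ω → Ω'} (hX : Measurable X) {ξ : Ω → EuclideanSpace ℝ (Fin d)} (hξm : Measurable ξ)
    (hξ : Integrable ξ P) (hmean : P[ξ | m'.comap X] =ᵐ[P] fun _ => 0) {σ : ℝ} (hσ : 0 < σ)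
    (hsub : ∀ u : Ω' → EuclideanSpace ℝ (Fin d), Measurable u → (∀ ω, ‖u ω‖ = 1) →
      Integrable (fun ω => Real.exp (⟪u (X ω), ξ ω⟫_ℝ ^ 2 / σ ^ 2)) P ∧
      ∀ᵐ ω ∂P,
        (P[fun ω' => Real.exp (⟪u (X ω'), ξ ω'⟫_ℝ ^ 2 / σ ^ 2) | m'.comap X]) ω ≤ 2)
    {b : Ω' → EuclideanSpace ℝ (Fin d)} (hb : Measurable b) {g : Ω' → ℝ} (hg : Measurable g)
    {r : ℝ} (hr : 0 ≤ r) (hr1 : 2 * r * d * σ ^ 2 ≤ 1) :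
    ∫⁻ ω, ENNReal.ofReal (Real.exp (g (X ω) + (⟪b (X ω), ξ ω⟫_ℝ + r * ‖ξ ω‖ ^ 2))) ∂P
      ≤ ∫⁻ ω, ENNReal.ofReal (Real.exp
          (g (X ω) + (4 * σ ^ 2 * ‖b (X ω)‖ ^ 2 + 2 * r * d * σ ^ 2))) ∂P := by
  have hker : ∀ u : Ω' → EuclideanSpace ℝ (Fin d), Measurable u → (∀ ω, ‖u ω‖ = 1) →
      ∀ᵐ ω ∂P, Integrable (fun x => Real.exp (⟪u (X ω), x⟫_ℝ ^ 2 / σ ^ 2))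
          (condDistrib ξ X P (X ω)) ∧
        ∫ x, Real.exp (⟪u (X ω), x⟫_ℝ ^ 2 / σ ^ 2) ∂(condDistrib ξ X P (X ω)) ≤ 2 := by
    intro u hu hu1
    obtain ⟨h1, h2⟩ := hsub u hu hu1
    let f : Ω' × EuclideanSpace ℝ (Fin d) → ℝ :=
      fun z => Real.exp (⟪u z.1, z.2⟫_ℝ ^ 2 / σ ^ 2)
    have hf : Measurable f := by fun_prop
    have hfi : Integrable f (P.map fun a => (X a, ξ a)) :=
      (integrable_map_measure hf.aestronglyMeasurable (hX.prodMk hξm).aemeasurable).2 h1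
    filter_upwards [h2, hfi.condDistrib_ae hX.aemeasurable hξm.aemeasurable,
      condExp_prod_ae_eq_integral_condDistrib' hX hξm.aemeasurable hfi] with ω h2 h3 h4
    exact ⟨h3, h4 ▸ h2⟩
  have hmeanker : ∀ᵐ ω ∂P, Integrable (fun x => x) (condDistrib ξ X P (X ω)) ∧
      ∫ x, x ∂(condDistrib ξ X P (X ω)) = 0 := by
    have hfi : Integrable (fun z : Ω' × EuclideanSpace ℝ (Fin d) => z.2)
        (P.map fun a => (X a, ξ a)) :=
      (integrable_map_measure measurable_snd.aestronglyMeasurable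
        (hX.prodMk hξm).aemeasurable).2 hξ
    filter_upwards [hmean, hfi.condDistrib_ae hX.aemeasurable hξm.aemeasurable,
      condExp_prod_ae_eq_integral_condDistrib' hX hξm.aemeasurable hfi] with ω h2 h3 h4
    exact ⟨h3, h4 ▸ h2⟩
  have hcoord := ae_all_iff.2 fun i : Fin d =>
    hker (fun _ => EuclideanSpace.single i (1 : ℝ)) measurable_const (fun _ => by simp)
  classical
  let u : Ω' → EuclideanSpace ℝ (Fin d) := fun ω =>
    if b ω = 0 then EuclideanSpace.single ⟨0, hd⟩ (1 : ℝ) else (‖b ω‖)⁻¹ • b ω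
  have hum : Measurable u :=
    Measurable.ite (hb (measurableSet_singleton 0)) measurable_const (hb.norm.inv.smul hb)
  have hu1 : ∀ ω, ‖u ω‖ = 1 := fun ω => by
    by_cases h : b ω = 0
    · simp [u, h]
    · simp [u, h, norm_smul]
  have hbu : ∀ ω, b ω = ‖b ω‖ • u ω := fun ω => by
    by_cases h : b ω = 0
    · simp [h]
    · simp [u, h, smul_smul]
  rw [lintegral_comp_prodMk_eq_lintegral_condDistrib (P := P) (X := X) (Y := ξ)
    (f := fun z => ENNReal.ofReal (Real.exp (g z.1 + (⟪b z.1, z.2⟫_ℝ + r * ‖z.2‖ ^ 2)))) hX hξm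
    (by fun_prop)]
  refine lintegral_mono_ae ?_
  filter_upwards [hmeanker, hcoord, hker u hum hu1] with ω h1 h2 h3
  simp only [Real.exp_add (g (X ω)), ENNReal.ofReal_mul (Real.exp_pos (g (X ω))).le]
  rw [lintegral_const_mul _ (by fun_prop)]
  exact mul_le_mul_right
    (lintegral_exp_inner_add_norm_sq_le hd hσ h1.1 h1.2 h2 (hbu (X ω)) h3 hr hr1) _

/-- One noisy step from a `𝒢`-measurable point `b`: exponential moment of the squared norm,
discounted by a `𝒢`-measurable `s`. -/
lemma lintegral_exp_norm_sub_smul_sq_le {Ω : Type*} {𝒢 m0 : MeasurableSpace Ω} (h𝒢 : 𝒢 ≤ m0)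
    {P : Measure Ω} [IsProbabilityMeasure P] {d : ℕ} (hd : 1 ≤ d)
    {ξ : Ω → EuclideanSpace ℝ (Fin d)} (hξ : Integrable ξ P) (hξm : StronglyMeasurable[m0] ξ)
    (hmean : P[ξ | 𝒢] =ᵐ[P] fun _ => 0) {σ μ γ κ : ℝ} (hσ : 0 < σ) (hγ : 0 < γ)
    (hsub : ∀ u : Ω → EuclideanSpace ℝ (Fin d), StronglyMeasurable[𝒢] u → (∀ ω, ‖u ω‖ = 1) →
      Integrable (fun ω => Real.exp (⟪u ω, ξ ω⟫_ℝ ^ 2 / σ ^ 2)) P ∧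
      ∀ᵐ ω ∂P, (P[fun ω' => Real.exp (⟪u ω', ξ ω'⟫_ℝ ^ 2 / σ ^ 2) | 𝒢]) ω ≤ 2)
    {b : Ω → EuclideanSpace ℝ (Fin d)} (hb : StronglyMeasurable[𝒢] b) {s : Ω → ℝ}
    (hs : StronglyMeasurable[𝒢] s) (hκ : 0 ≤ κ) (hκμ : 64 * κ * σ ^ 2 * γ ≤ μ)
    (hκd : 2 * κ * γ ^ 2 * d * σ ^ 2 ≤ 1) :
    ∫⁻ ω, ENNReal.ofReal (Real.exp (κ * ‖b ω - γ • ξ ω‖ ^ 2 - s ω)) ∂P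
      ≤ ∫⁻ ω, ENNReal.ofReal (Real.exp
          (κ * ((1 + γ * μ / 4) * ‖b ω‖ ^ 2 + 2 * γ ^ 2 * d * σ ^ 2) - s ω)) ∂P := by
  have h := lintegral_exp_add_inner_add_norm_sq_le (m0 := m0) (m' := 𝒢) (P := P) hd (X := id)
    (measurable_id'' h𝒢) hξm.measurable hξ (by rwa [MeasurableSpace.comap_id]) hσ
    (by
      rw [MeasurableSpace.comap_id]
      exact fun u hu hu1 => hsub u hu.stronglyMeasurable hu1)
    (b := fun ω => (-2 * γ * κ) • b ω) (hb.const_smul (-2 * γ * κ)).measurable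
    (g := fun ω => κ * ‖b ω‖ ^ 2 - s ω) (((hb.norm.pow 2).const_mul κ).sub hs).measurable
    (r := κ * γ ^ 2) (by positivity) (by linarith)
  simp only [id] at h
  refine (le_of_eq (lintegral_congr fun ω => ?_)).trans (h.trans (lintegral_mono fun ω => ?_))
  · congr 2
    rw [norm_sub_sq_real, real_inner_smul_left, real_inner_smul_right, norm_smul, mul_pow,
      Real.norm_eq_abs, sq_abs]
    ring
  · refine ENNReal.ofReal_le_ofReal (Real.exp_le_exp.2 ?_)
    rw [norm_smul, mul_pow, Real.norm_eq_abs, sq_abs]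
    have := mul_le_mul_of_nonneg_left hκμ (show 0 ≤ κ * γ * ‖b ω‖ ^ 2 / 4 by positivity)
    nlinarith

lemma norm_sub_smul_sq_le {E : Type*} [NormedAddCommGroup E] [InnerProductSpace ℝ E]
    {μ L γ : ℝ} (hγ : 0 ≤ γ) (hL : γ * L ^ 2 ≤ μ) {a g : E}
    (hmono : μ * ‖a‖ ^ 2 ≤ ⟪g, a⟫_ℝ) (hlip : ‖g‖ ≤ L * ‖a‖) :
    ‖a - γ • g‖ ^ 2 ≤ (1 - γ * μ) * ‖a‖ ^ 2 := by
  rw [norm_sub_sq_real, real_inner_smul_right, norm_smul, mul_pow, Real.norm_eq_abs, sq_abs,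
    real_inner_comm]
  have h1 : ‖g‖ ^ 2 ≤ (L * ‖a‖) ^ 2 := pow_le_pow_left₀ (norm_nonneg _) hlip 2
  have h2 := mul_le_mul_of_nonneg_left h1 (sq_nonneg γ)
  have h3 := mul_le_mul_of_nonneg_left hL (show 0 ≤ γ * ‖a‖ ^ 2 by positivity)
  have h4 := mul_le_mul_of_nonneg_left hmono hγ
  nlinarith

/-- Young inequality in the form that absorbs the drift `v` into the contraction. -/
lemma contraction_mul_norm_add_sq_le {E : Type*} [NormedAddCommGroup E] {x : ℝ} (hx : 0 < x)
    (hx1 : x ≤ 1) (e v : E) :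
    (1 + x / 4) * ((1 - x) * ‖e + v‖ ^ 2) ≤ (1 - x / 2) * ‖e‖ ^ 2 + 5 / x * ‖v‖ ^ 2 := by
  have h1 : ‖e + v‖ ^ 2 ≤ (1 + x / 4) * ‖e‖ ^ 2 + (1 + 4 / x) * ‖v‖ ^ 2 := by
    have h2 := pow_le_pow_left₀ (norm_nonneg _) (norm_add_le e v) 2
    have h3 : 0 ≤ (x / 4) * (‖e‖ - 4 / x * ‖v‖) ^ 2 := by positivity
    have h4 : (x / 4) * (‖e‖ - 4 / x * ‖v‖) ^ 2
        = x / 4 * ‖e‖ ^ 2 - 2 * ‖e‖ * ‖v‖ + 4 / x * ‖v‖ ^ 2 := by field_simp; ring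
    nlinarith
  have h5 := mul_le_mul_of_nonneg_left h1
    (show 0 ≤ (1 + x / 4) * (1 - x) from mul_nonneg (by linarith) (by linarith))
  have h6 : (1 + x / 4) * (1 - x) * (1 + x / 4) ≤ 1 - x / 2 := by nlinarith [sq_nonneg x]
  have h7 : (1 + x / 4) * (1 - x) * (1 + 4 / x) ≤ 5 / x := by
    have h8 : (1 + x / 4) * (1 - x) ≤ 1 := by nlinarith
    have h9 : 1 + 4 / x ≤ 5 / x := by
      rw [le_div_iff₀ hx, add_mul, div_mul_cancel₀ _ hx.ne']; linarith
    have h10 : 0 ≤ 1 + 4 / x := by positivity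
    nlinarith
  have h11 := mul_le_mul_of_nonneg_right h6 (sq_nonneg ‖e‖)
  have h12 := mul_le_mul_of_nonneg_right h7 (sq_nonneg ‖v‖)
  nlinarith

lemma sum_range_pow_sub_le {q : ℝ} (hq0 : 0 ≤ q) (hq1 : q < 1) (T : ℕ) :
    ∑ ℓ ∈ Finset.range T, q ^ (T - ℓ - 1) ≤ 1 / (1 - q) := by
  have h : ∑ ℓ ∈ Finset.range T, q ^ (T - ℓ - 1) = ∑ ℓ ∈ Finset.range T, q ^ ℓ := by
    rw [← Finset.sum_range_reflect]
    refine Finset.sum_congr rfl fun ℓ hℓ => ?_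
    have := Finset.mem_range.1 hℓ
    congr 1
    omega
  rw [h, le_div_iff₀ (by linarith), mul_comm, mul_neg_geom_sum]
  linarith [pow_nonneg hq0 T]

/-- Chernoff bound with an exponential moment in `ℝ≥0∞`. -/
lemma ofReal_one_sub_le_measure_lt_of_lintegral_exp_le {Ω : Type*} {m0 : MeasurableSpace Ω}
    {P : Measure Ω} [IsProbabilityMeasure P] {G : Ω → ℝ} (hG : Measurable G) {c δ : ℝ}
    (hδ : 0 < δ) (h : ∫⁻ ω, ENNReal.ofReal (Real.exp (G ω)) ∂P ≤ ENNReal.ofReal (Real.exp c)) :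
    ENNReal.ofReal (1 - δ) ≤ P {ω | G ω < c + Real.log (1 / δ)} := by
  have hset : MeasurableSet {ω | G ω < c + Real.log (1 / δ)} :=
    measurableSet_lt hG measurable_const
  have hmarkov := meas_ge_le_lintegral_div (μ := P)
    (f := fun ω => ENNReal.ofReal (Real.exp (G ω))) (by fun_prop)
    (ε := ENNReal.ofReal (Real.exp (c + Real.log (1 / δ))))
    (by simp [Real.exp_pos]) ENNReal.ofReal_ne_top
  have hcompl : P {ω | G ω < c + Real.log (1 / δ)}ᶜ ≤ ENNReal.ofReal δ := by
    calc _ ≤ P {ω | ENNReal.ofReal (Real.exp (c + Real.log (1 / δ)))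
            ≤ ENNReal.ofReal (Real.exp (G ω))} := by
          refine measure_mono fun ω hω => ?_
          simp only [Set.mem_compl_iff, Set.mem_ofPred_eq, not_lt] at hω
          exact ENNReal.ofReal_le_ofReal (Real.exp_le_exp.2 hω)
      _ ≤ _ := hmarkov
      _ ≤ ENNReal.ofReal (Real.exp c) / ENNReal.ofReal (Real.exp (c + Real.log (1 / δ))) := by
          gcongr
      _ = ENNReal.ofReal δ := by
          rw [← ENNReal.ofReal_div_of_pos (Real.exp_pos _), Real.exp_add,
            Real.exp_log (by positivity)]
          congr 1
          have := Real.exp_ne_zero c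
          field_simp
  rw [ENNReal.ofReal_sub _ hδ.le, ENNReal.ofReal_one, ← prob_add_prob_compl (μ := P) hset]
  exact tsub_le_iff_right.2 (add_le_add le_rfl hcompl)

/-- Time-resolved high-probability tracking error bound for nonstationary SGD under
conditionally sub-Gaussian gradient noise along the iterates: with probability at
least `1 − δ`, the squared tracking error at time `T` is bounded, up to a universal
constant, by the transient, the exponentially-weighted drift functional `𝔇_T/(γμ)`,
the noise floor, and drift–noise interaction terms. -/
theorem sgd_high_probability_tracking_error :
    ∃ C : ℝ, 0 < C ∧
      ∀ (d : ℕ), 1 ≤ d →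
      ∀ (μ L σ : ℝ), 0 < μ → 0 < L → 0 < σ →
      ∀ (Ω : Type) (m0 : MeasurableSpace Ω) (P : Measure Ω), IsProbabilityMeasure P →
      ∀ (ℱ : Filtration ℕ m0)
        (m : ℕ → EuclideanSpace ℝ (Fin d) → Ω → EuclideanSpace ℝ (Fin d))
        (θ θstar ξ : ℕ → Ω → EuclideanSpace ℝ (Fin d))
        (θ0 θstar0 : EuclideanSpace ℝ (Fin d)),
        θ 0 = (fun _ => θ0) → θstar 0 = (fun _ => θstar0) →
        (∀ t x, StronglyMeasurable[ℱ t] (m t x)) →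
        (∀ t ω x y, μ * ‖x - y‖ ^ 2 ≤ ⟪m t x ω - m t y ω, x - y⟫_ℝ) →
        (∀ t ω x y, ‖m t x ω - m t y ω‖ ≤ L * ‖x - y‖) →
        (∀ t, StronglyMeasurable[ℱ t] (θstar (t + 1))) →
        (∀ t, ∀ᵐ ω ∂P, m t (θstar (t + 1) ω) ω = 0) →
        (∀ t, StronglyMeasurable[ℱ t] (θ t)) →
      ∀ (γ : ℝ), 0 < γ → γ ≤ min (μ / L ^ 2) (1 / L) →
        (∀ t ω, θ (t + 1) ω = θ t ω - γ • m t (θ t ω) ω - γ • ξ t ω) →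
        (∀ t, StronglyMeasurable[ℱ (t + 1)] (ξ t)) →
        (∀ t, Integrable (ξ t) P) →
        (∀ t, P[ξ t | ℱ t] =ᵐ[P] fun _ => 0) →
        -- conditionally σ-sub-Gaussian noise along the iterates
        (∀ t (u : Ω → EuclideanSpace ℝ (Fin d)), StronglyMeasurable[ℱ t] u →
          (∀ ω, ‖u ω‖ = 1) →
          Integrable (fun ω => Real.exp (⟪u ω, ξ t ω⟫_ℝ ^ 2 / σ ^ 2)) P ∧
          ∀ᵐ ω ∂P,
            (P[fun ω' => Real.exp (⟪u ω', ξ t ω'⟫_ℝ ^ 2 / σ ^ 2) | ℱ t]) ω ≤ 2) →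
      ∀ (T : ℕ), 1 ≤ T → ∀ δ : ℝ, 0 < δ → δ < 1 →
        ENNReal.ofReal (1 - δ) ≤
          P {ω | ‖θ T ω - θstar T ω‖ ^ 2 ≤
            C * ((1 - γ * μ / 2) ^ T * ‖θ0 - θstar0‖ ^ 2
              + (∑ ℓ ∈ Finset.range T, (1 - γ * μ / 2) ^ (T - ℓ - 1)
                  * ‖θstar ℓ ω - θstar (ℓ + 1) ω‖ ^ 2) / (γ * μ)
              + (d : ℝ) * σ ^ 2 * γ / μ
              + ((d : ℝ) * σ ^ 2 * γ ^ 2 + (d : ℝ) ^ 2 * σ ^ 4 * γ ^ 3 / μ)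
                  * Real.log (2 * T / δ)
              + (σ ^ 2 * γ / μ
                  + γ ^ 2 * σ ^ 2
                    * (⨆ t ∈ Finset.Icc 1 T, ∑ ℓ ∈ Finset.range t,
                        (1 - γ * μ / 2) ^ (2 * (t - ℓ - 1))
                          * ‖θstar ℓ ω - θstar (ℓ + 1) ω‖ ^ 2))
                  * Real.log (2 * T / δ))} := by
  refine ⟨64, by norm_num, ?_⟩
  intro d hd μ L σ hμ hL hσ Ω m0 P hP ℱ m θ θstar ξ θ0 θstar0 hθ0 hθstar0 hm hmono hlip hθstar
    hroot hθ γ hγ hγle hrec hξm hξ hξ0 hsub T hT δ hδ hδ1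
  have hd0 : (0 : ℝ) < d := by exact_mod_cast hd
  have hγ1 : γ * L ^ 2 ≤ μ := (le_div_iff₀ (by positivity)).1 (hγle.trans (min_le_left _ _))
  have hγ2 : γ * L ≤ 1 := (le_div_iff₀ hL).1 (hγle.trans (min_le_right _ _))
  obtain ⟨ω0⟩ : Nonempty Ω := P.nonempty_of_neZero
  have hμL : μ ≤ L := by
    let e : EuclideanSpace ℝ (Fin d) := EuclideanSpace.single ⟨0, hd⟩ 1
    have he : ‖e - 0‖ = 1 := by simp [e]
    have h1 := hmono 0 ω0 e 0
    have h2 := hlip 0 ω0 e 0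
    have h3 := real_inner_le_norm (m 0 e ω0 - m 0 0 ω0) (e - 0)
    rw [he] at h1 h2 h3
    linarith
  have hx : 0 < γ * μ := by positivity
  have hx1 : γ * μ ≤ 1 := (mul_le_mul_of_nonneg_left hμL hγ.le).trans hγ2
  set q : ℝ := 1 - γ * μ / 2 with hq
  have hq0 : 0 < q := by rw [hq]; linarith
  have hq1 : q < 1 := by rw [hq]; linarith
  let K : ℝ := 64 * σ ^ 2 * γ / μ + 2 * γ ^ 2 * d * σ ^ 2
  have hK : 0 < K := by positivity
  have hKμ : 64 * σ ^ 2 * γ ≤ μ * K := by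
    have : μ * (64 * σ ^ 2 * γ / μ) = 64 * σ ^ 2 * γ := by field_simp
    have : 0 ≤ μ * (2 * γ ^ 2 * d * σ ^ 2) := by positivity
    simp only [K]
    linarith
  have hKd : 2 * γ ^ 2 * d * σ ^ 2 ≤ K := by
    have : 0 ≤ 64 * σ ^ 2 * γ / μ := by positivity
    simp only [K]
    linarith
  -- the drift and noise accumulated before time `t`, discounted to the horizon `T`
  let S : ℕ → Ω → ℝ := fun t ω => ∑ ℓ ∈ Finset.range t, q ^ (T - ℓ - 1) *
    (5 / (γ * μ) * ‖θstar ℓ ω - θstar (ℓ + 1) ω‖ ^ 2 + 2 * γ ^ 2 * d * σ ^ 2)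
  let G : ℕ → Ω → ℝ := fun t ω => K⁻¹ * q ^ (T - t) * ‖θ t ω - θstar t ω‖ ^ 2 - K⁻¹ * S t ω
  have hθstar' : ∀ t, StronglyMeasurable[ℱ t] (θstar t) := by
    rintro (_ | t)
    · rw [hθstar0]; exact stronglyMeasurable_const
    · exact (hθstar t).mono (ℱ.mono t.le_succ)
  have hSm : ∀ t, StronglyMeasurable[ℱ t] (S (t + 1)) := fun t => by
    refine Finset.stronglyMeasurable_fun_sum _ fun ℓ hℓ => ?_
    have hℓt : ℓ ≤ t := Nat.lt_succ_iff.1 (Finset.mem_range.1 hℓ)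
    exact (((((((hθstar' ℓ).sub (hθstar ℓ)).norm.pow 2).const_mul _).add
      stronglyMeasurable_const).const_mul _).mono (ℱ.mono hℓt))
  have hmθ : ∀ t, StronglyMeasurable[ℱ t] (fun ω => m t (θ t ω) ω) := fun t => by
    have hcont : ∀ ω, Continuous fun x => m t x ω := fun ω =>
      (LipschitzWith.of_dist_le_mul (K := ⟨L, hL.le⟩) fun x y => by
        rw [dist_eq_norm, dist_eq_norm]; exact hlip t ω x y).continuous
    have h := @stronglyMeasurable_uncurry_of_continuous_of_stronglyMeasurable Ω
      (EuclideanSpace ℝ (Fin d)) (EuclideanSpace ℝ (Fin d)) _ _ _ _ _ _ _ (ℱ t) (m t) hcont (hm t)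
    exact h.comp_measurable ((hθ t).measurable.prodMk measurable_id)
  have hstep : ∀ t, t < T → ∫⁻ ω, ENNReal.ofReal (Real.exp (G (t + 1) ω)) ∂P
      ≤ ∫⁻ ω, ENNReal.ofReal (Real.exp (G t ω)) ∂P := by
    intro t ht
    set κ : ℝ := K⁻¹ * q ^ (T - t - 1) with hκ
    have hκ0 : 0 ≤ κ := by positivity
    have hκK : κ * K ≤ 1 := by
      have h1 : κ * K = q ^ (T - t - 1) := by rw [hκ]; field_simp
      rw [h1]
      exact pow_le_one₀ hq0.le hq1.le
    have hκμ : 64 * κ * σ ^ 2 * γ ≤ μ := by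
      have h1 := mul_le_mul_of_nonneg_left hKμ hκ0
      have h2 := mul_le_mul_of_nonneg_left hκK hμ.le
      linarith
    have hκd : 2 * κ * γ ^ 2 * d * σ ^ 2 ≤ 1 := by
      have h1 := mul_le_mul_of_nonneg_left hKd hκ0
      linarith
    have h := lintegral_exp_norm_sub_smul_sq_le (ℱ.le t) (P := P) hd (hξ t)
      ((hξm t).mono (ℱ.le _)) (hξ0 t) hσ hγ (hsub t)
      (((hθ t).sub (hθstar t)).sub ((hmθ t).const_smul γ)) ((hSm t).const_mul K⁻¹) hκ0 hκμ hκd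
    refine (le_of_eq (lintegral_congr fun ω => ?_)).trans (h.trans (lintegral_mono_ae ?_))
    · simp only [G, Pi.sub_apply, Pi.smul_apply]
      rw [hrec t ω, hκ, ← Nat.sub_sub]
      congr 6
      abel
    · filter_upwards [hroot t] with ω hω
      refine ENNReal.ofReal_le_ofReal (Real.exp_le_exp.2 ?_)
      have hmon := hmono t ω (θ t ω) (θstar (t + 1) ω)
      have hli := hlip t ω (θ t ω) (θstar (t + 1) ω)
      rw [hω, sub_zero] at hmon hli
      have h1 := norm_sub_smul_sq_le hγ.le hγ1 hmon hli
      have h2 := contraction_mul_norm_add_sq_le hx hx1 (θ t ω - θstar t ω)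
        (θstar t ω - θstar (t + 1) ω)
      rw [sub_add_sub_cancel, ← hq] at h2
      have h3 := mul_le_mul_of_nonneg_left h1 (show 0 ≤ 1 + γ * μ / 4 by positivity)
      have h4 := mul_le_mul_of_nonneg_left (h3.trans h2) hκ0
      have hS : S (t + 1) ω = S t ω + q ^ (T - t - 1) *
          (5 / (γ * μ) * ‖θstar t ω - θstar (t + 1) ω‖ ^ 2 + 2 * γ ^ 2 * d * σ ^ 2) :=
        Finset.sum_range_succ _ _
      have hpow : q ^ (T - t) = q ^ (T - t - 1) * q := by
        rw [← pow_succ]; congr 1; omega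
      simp only [G, Pi.sub_apply, Pi.smul_apply]
      rw [hS, hpow]
      rw [hκ] at h4 ⊢
      linarith
  have hind : ∀ t, t ≤ T → ∫⁻ ω, ENNReal.ofReal (Real.exp (G t ω)) ∂P
      ≤ ENNReal.ofReal (Real.exp (K⁻¹ * q ^ T * ‖θ0 - θstar0‖ ^ 2)) := by
    intro t
    induction t with
    | zero => intro _; simp [G, S, hθ0, hθstar0]
    | succ t ih => exact fun ht => (hstep t ht).trans (ih (by omega))
  have hGm : Measurable (G T) := by
    obtain ⟨n, rfl⟩ : ∃ n, T = n + 1 := ⟨T - 1, by omega⟩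
    exact (((((((hθ _).sub (hθstar' _)).norm.pow 2).const_mul _).mono (ℱ.le _)).sub
      (((hSm n).const_mul _).mono (ℱ.le _)))).measurable
  refine (ofReal_one_sub_le_measure_lt_of_lintegral_exp_le hGm hδ (hind T le_rfl)).trans
    (measure_mono fun ω hω => ?_)
  simp only [Set.mem_ofPred_eq, G, Nat.sub_self, pow_zero, mul_one] at hω ⊢
  set D := ∑ ℓ ∈ Finset.range T, q ^ (T - ℓ - 1) * ‖θstar ℓ ω - θstar (ℓ + 1) ω‖ ^ 2
  set D2 := ⨆ t ∈ Finset.Icc 1 T, ∑ ℓ ∈ Finset.range t,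
    q ^ (2 * (t - ℓ - 1)) * ‖θstar ℓ ω - θstar (ℓ + 1) ω‖ ^ 2
  set V := ‖θ T ω - θstar T ω‖ ^ 2
  have hD2 : 0 ≤ D2 := Real.iSup_nonneg fun t => Real.iSup_nonneg fun _ =>
    Finset.sum_nonneg fun ℓ _ => by positivity
  have hD : 0 ≤ D := Finset.sum_nonneg fun ℓ _ => by positivity
  have hS : S T ω ≤ 5 * (D / (γ * μ)) + 4 * (d * σ ^ 2 * γ / μ) := by
    have h1 : S T ω = 5 * (D / (γ * μ))
        + 2 * γ ^ 2 * d * σ ^ 2 * ∑ ℓ ∈ Finset.range T, q ^ (T - ℓ - 1) := by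
      have h2 : 5 * (D / (γ * μ)) = 5 / (γ * μ) * D := by ring
      rw [h2, Finset.mul_sum, Finset.mul_sum, ← Finset.sum_add_distrib]
      exact Finset.sum_congr rfl fun ℓ _ => by ring
    have h3 := mul_le_mul_of_nonneg_left (sum_range_pow_sub_le hq0.le hq1 T)
      (show 0 ≤ 2 * γ ^ 2 * d * σ ^ 2 by positivity)
    have h4 : 2 * γ ^ 2 * d * σ ^ 2 * (1 / (1 - q)) = 4 * (d * σ ^ 2 * γ / μ) := by
      rw [hq, sub_sub_cancel]; field_simp; ring
    linarith
  have hT1 : (1 : ℝ) ≤ T := by exact_mod_cast hT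
  have hlog : Real.log (1 / δ) ≤ Real.log (2 * T / δ) :=
    Real.log_le_log (by positivity) (by gcongr; linarith)
  have hlog0 : 0 ≤ Real.log (1 / δ) := Real.log_nonneg (by rw [le_div_iff₀ hδ]; linarith)
  set Λ := Real.log (2 * T / δ)
  have hV : V ≤ q ^ T * ‖θ0 - θstar0‖ ^ 2 + S T ω + K * Real.log (1 / δ) := by
    have h1 := mul_le_mul_of_nonneg_left hω.le hK.le
    have h2 : K * (K⁻¹ * V - K⁻¹ * S T ω) = V - S T ω := by field_simp
    have h3 : K * (K⁻¹ * q ^ T * ‖θ0 - θstar0‖ ^ 2 + Real.log (1 / δ))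
        = q ^ T * ‖θ0 - θstar0‖ ^ 2 + K * Real.log (1 / δ) := by field_simp
    rw [h2, h3] at h1
    linarith
  have hKΛ : K * Real.log (1 / δ)
      ≤ 64 * (σ ^ 2 * γ / μ) * Λ + 2 * (d * σ ^ 2 * γ ^ 2) * Λ := by
    refine (mul_le_mul_of_nonneg_left hlog hK.le).trans (le_of_eq ?_)
    simp only [K]; ring
  have hΛ : 0 ≤ Λ := hlog0.trans hlog
  have p1 : 0 ≤ q ^ T * ‖θ0 - θstar0‖ ^ 2 := by positivity
  have p2 : 0 ≤ D / (γ * μ) := by positivity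
  have p3 : 0 ≤ d * σ ^ 2 * γ / μ := by positivity
  have p4 : 0 ≤ d * σ ^ 2 * γ ^ 2 * Λ := by positivity
  have p5 : 0 ≤ d ^ 2 * σ ^ 4 * γ ^ 3 / μ * Λ := by positivity
  have p6 : 0 ≤ γ ^ 2 * σ ^ 2 * D2 * Λ := by positivity
  linarith
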